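/- For every prime p and every α > 0 there exist α' > 0 and γ > 0, which may be taken to satisfy α' = γ ≥ exp(−C·exp(1/α^C)) for a constant C = C(p) > 0 depending only on p, such that the following holds for all n sufficiently large in terms of p and α: if f : 𝔽_p^n → {0,1} has average E[f] = α over uniform input and is restricted 3-AP free, then there exist a natural number n' ≥ γ·n and a function g : 𝔽_p^{n'} → {0,1} which is restricted 3-AP free and satisfies E[g] ≥ α + α'. -/

import Mathlib

/-- A function `f : 𝔽_p^n → {0,1}` (with values in `ℝ`) is restricted 3-AP free if there is no
`x` and nonzero `a` with all coordinates in `{0,1,2}` such that `f` is `1` at `x`, `x+a`, `x+2a`. -/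
def Restricted3APFree {p n : ℕ} (f : (Fin n → ZMod p) → ℝ) : Prop :=
  ∀ x a : Fin n → ZMod p, (∀ i, a i = 0 ∨ a i = 1 ∨ a i = 2) → a ≠ 0 →
    ¬(f x = 1 ∧ f (x + a) = 1 ∧ f (x + 2 • a) = 1)

section RestrictedProgressions

open Finset
open scoped BigOperators ComplexConjugate

section Averages

variable {G : Type*} [AddCommGroup G] [Fintype G]

lemma expect_add_right {M : Type*} [AddCommMonoid M] [Module ℚ≥0 M] (F : G → M) (c : G) :
    𝔼 x, F (x + c) = 𝔼 x, F x :=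
  Fintype.expect_equiv (Equiv.addRight c) _ _ fun _ => rfl

lemma sq_expect_mul_le {X : Type*} [Fintype X] [Nonempty X] (a b : X → ℝ)
    (ha : ∀ x, |a x| ≤ 1) : (𝔼 x, a x * b x) ^ 2 ≤ 𝔼 x, b x ^ 2 := by
  refine (expect_mul_sq_le_sq_mul_sq univ a b).trans ?_
  have h1 : 𝔼 x, a x ^ 2 ≤ 1 :=
    expect_le univ_nonempty fun x _ => (sq_le_one_iff_abs_le_one _).2 (ha x)
  exact mul_le_of_le_one_left (expect_nonneg fun x _ => sq_nonneg _) h1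

lemma sq_expect_le {X : Type*} [Fintype X] [Nonempty X] (b : X → ℝ) :
    (𝔼 x, b x) ^ 2 ≤ 𝔼 x, b x ^ 2 := by
  simpa using sq_expect_mul_le (fun _ => 1) b (by simp)

lemma sq_expect_expect_mul_le {X Y : Type*} [Fintype X] [Nonempty X] [Fintype Y] [Nonempty Y]
    (a b : X → Y → ℝ) (ha : ∀ x y, |a x y| ≤ 1) :
    (𝔼 x, 𝔼 y, a x y * b x y) ^ 2 ≤ 𝔼 x, 𝔼 y, b x y ^ 2 :=
  (sq_expect_le _).trans (expect_le_expect fun x _ => sq_expect_mul_le _ _ (ha x))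

lemma abs_mul_le_one {a b : ℝ} (ha : |a| ≤ 1) (hb : |b| ≤ 1) : |a * b| ≤ 1 := by
  rw [abs_mul]; exact mul_le_one₀ ha (abs_nonneg _) hb

/-- The weighted count of progressions `y - e u - e t, y, y + e u + e t`. -/
noncomputable def progressionCount {U : Type*} [Fintype U] (e : U → G) (f₁ f₂ f₃ : G → ℝ) : ℝ :=
  𝔼 t, 𝔼 y, 𝔼 u, f₁ (y - (e u + e t)) * f₂ y * f₃ (y + (e u + e t))

lemma progressionCount_pow_four_le {U : Type*} [Fintype U] [Nonempty U] (e : U → G)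
    (f₁ f₂ g : G → ℝ) (h₁ : ∀ x, |f₁ x| ≤ 1) (h₂ : ∀ x, |f₂ x| ≤ 1) :
    progressionCount e f₁ f₂ g ^ 4 ≤
      𝔼 u, 𝔼 u', 𝔼 z, (𝔼 t, g (z + (e t + e t)) * g (z + (e t + e t) + (e u' - e u))) ^ 2 := by
  have key : progressionCount e f₁ f₂ g ^ 2 ≤
      𝔼 u, 𝔼 u', 𝔼 z, (f₁ z * f₁ (z - (e u' - e u))) *
        𝔼 t, g (z + (e u + e u) + (e t + e t)) *
          g (z + (e u + e u) + (e t + e t) + (e u' - e u)) := by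
    calc progressionCount e f₁ f₂ g ^ 2
        = (𝔼 t, 𝔼 y, f₂ y * 𝔼 u, f₁ (y - (e u + e t)) * g (y + (e u + e t))) ^ 2 := by
          unfold progressionCount
          simp only [mul_expect]
          refine congrArg (· ^ 2) (expect_congr rfl fun t _ => expect_congr rfl fun y _ =>
            expect_congr rfl fun u _ => ?_)
          ring
      _ ≤ 𝔼 t, 𝔼 y, (𝔼 u, f₁ (y - (e u + e t)) * g (y + (e u + e t))) ^ 2 :=
          sq_expect_expect_mul_le _ _ fun _ y => h₂ y
      _ = 𝔼 t, 𝔼 u, 𝔼 u', 𝔼 y, f₁ (y - (e u + e t)) * g (y + (e u + e t)) *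
            (f₁ (y - (e u' + e t)) * g (y + (e u' + e t))) := by
          refine expect_congr rfl fun t _ => ?_
          simp only [sq, Fintype.expect_mul_expect]
          rw [expect_comm]
          refine expect_congr rfl fun u _ => ?_
          rw [expect_comm]
      _ = 𝔼 u, 𝔼 u', 𝔼 t, 𝔼 z, f₁ z * f₁ (z - (e u' - e u)) *
            (g (z + (e u + e u) + (e t + e t)) *
              g (z + (e u + e u) + (e t + e t) + (e u' - e u))) := by
          rw [expect_comm]
          refine expect_congr rfl fun u _ => ?_
          rw [expect_comm]
          refine expect_congr rfl fun u' _ => expect_congr rfl fun t _ => ?_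
          rw [← expect_add_right _ (e u + e t)]
          refine expect_congr rfl fun z _ => ?_
          rw [show z + (e u + e t) - (e u + e t) = z by abel,
            show z + (e u + e t) - (e u' + e t) = z - (e u' - e u) by abel,
            show z + (e u + e t) + (e u + e t) = z + (e u + e u) + (e t + e t) by abel,
            show z + (e u + e t) + (e u' + e t) =
              z + (e u + e u) + (e t + e t) + (e u' - e u) by abel]
          ring
      _ = _ := by
          refine expect_congr rfl fun u _ => expect_congr rfl fun u' _ => ?_
          rw [expect_comm]
          simp only [mul_expect]
  calc progressionCount e f₁ f₂ g ^ 4 = (progressionCount e f₁ f₂ g ^ 2) ^ 2 := by ring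
    _ ≤ _ := pow_le_pow_left₀ (sq_nonneg _) key 2
    _ ≤ _ := sq_expect_le _
    _ ≤ _ := by
        refine expect_le_expect fun u _ => (sq_expect_expect_mul_le _ _ fun u' z =>
          abs_mul_le_one (h₁ _) (h₁ _)).trans_eq ?_
        refine expect_congr rfl fun u' _ => ?_
        exact expect_add_right
          (fun z => (𝔼 t, g (z + (e t + e t)) * g (z + (e t + e t) + (e u' - e u))) ^ 2) (e u + e u)

lemma sum_norm_sq_expect_mul_addChar (φ : G → ℝ) :
    ∑ ψ : AddChar G ℂ, ‖𝔼 x, (φ x : ℂ) * ψ x‖ ^ 2 = 𝔼 x, φ x ^ 2 := by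
  classical
  have h : ∀ ψ : AddChar G ℂ, ((‖𝔼 x, (φ x : ℂ) * ψ x‖ ^ 2 : ℝ) : ℂ) =
      𝔼 x, 𝔼 y, (φ x * φ y : ℂ) * ψ (x - y) := by
    intro ψ
    rw [Complex.ofReal_pow, ← Complex.mul_conj', map_expect, expect_mul_expect]
    refine expect_congr rfl fun x _ => expect_congr rfl fun y _ => ?_
    rw [map_mul, Complex.conj_ofReal, ← AddChar.map_neg_eq_conj, sub_eq_add_neg,
      AddChar.map_add_eq_mul]
    ring
  rw [← Complex.ofReal_inj, Complex.ofReal_sum, sum_congr rfl fun ψ _ => h ψ,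
    ← expect_sum_comm]
  push_cast
  refine expect_congr rfl fun x _ => ?_
  rw [← expect_sum_comm]
  simp only [← mul_sum, AddChar.sum_apply_eq_ite, sub_eq_zero, mul_ite, mul_zero]
  rw [Fintype.expect_ite_eq, NNRat.smul_def]
  have : (Fintype.card G : ℂ) ≠ 0 := by simp
  push_cast
  field_simp

/-- The inverse theorem for the `U²` norm. -/
lemma exists_addChar_expect_le (φ : G → ℝ) (hφ : ∀ x, |φ x| ≤ 1) :
    ∃ ψ : AddChar G ℂ, 𝔼 x, 𝔼 h, 𝔼 k, φ x * φ (x + h) * (φ (x + k) * φ (x + h + k)) ≤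
      ‖𝔼 x, (φ x : ℂ) * ψ x‖ ^ 2 := by
  classical
  set A : G → ℝ := fun h => 𝔼 x, φ x * φ (x + h) with hA
  have hbox : 𝔼 x, 𝔼 h, 𝔼 k, φ x * φ (x + h) * (φ (x + k) * φ (x + h + k)) = 𝔼 h, A h ^ 2 := by
    rw [expect_comm]
    refine expect_congr rfl fun h _ => ?_
    rw [sq, hA, expect_mul_expect]
    refine expect_congr rfl fun x _ => ?_
    conv_rhs => rw [← expect_add_right _ x]
    refine expect_congr rfl fun k _ => ?_
    rw [add_comm k x, add_right_comm]
  have hAψ : ∀ ψ : AddChar G ℂ, 𝔼 h, (A h : ℂ) * ψ h =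
      ((‖𝔼 x, (φ x : ℂ) * ψ x‖ ^ 2 : ℝ) : ℂ) := by
    intro ψ
    rw [Complex.ofReal_pow, ← Complex.mul_conj', map_expect, mul_comm, expect_mul_expect]
    simp only [hA]
    push_cast
    simp only [expect_mul]
    rw [expect_comm]
    refine expect_congr rfl fun x _ => ?_
    rw [← expect_add_right _ (-x)]
    refine expect_congr rfl fun y _ => ?_
    rw [map_mul, Complex.conj_ofReal, ← AddChar.map_neg_eq_conj, AddChar.map_add_eq_mul,
      show x + (y + -x) = y by abel]
    ring
  obtain ⟨ψ, -, hψ⟩ := exists_max_image univ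
    (fun ψ : AddChar G ℂ => ‖𝔼 x, (φ x : ℂ) * ψ x‖ ^ 2) univ_nonempty
  refine ⟨ψ, ?_⟩
  rw [hbox, ← sum_norm_sq_expect_mul_addChar]
  calc ∑ χ : AddChar G ℂ, ‖𝔼 h, (A h : ℂ) * χ h‖ ^ 2
      = ∑ χ : AddChar G ℂ, ‖𝔼 x, (φ x : ℂ) * χ x‖ ^ 2 * ‖𝔼 x, (φ x : ℂ) * χ x‖ ^ 2 := by
        refine sum_congr rfl fun χ _ => ?_
        rw [hAψ, Complex.norm_real, Real.norm_eq_abs, sq_abs, sq (‖_‖ ^ 2)]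
    _ ≤ ∑ χ : AddChar G ℂ, ‖𝔼 x, (φ x : ℂ) * ψ x‖ ^ 2 * ‖𝔼 x, (φ x : ℂ) * χ x‖ ^ 2 :=
        sum_le_sum fun χ hχ => mul_le_mul_of_nonneg_right (hψ χ hχ) (sq_nonneg _)
    _ = ‖𝔼 x, (φ x : ℂ) * ψ x‖ ^ 2 * 𝔼 x, φ x ^ 2 := by
        rw [← mul_sum, sum_norm_sq_expect_mul_addChar]
    _ ≤ _ := mul_le_of_le_one_right (sq_nonneg _)
        (expect_le univ_nonempty fun x _ => (sq_le_one_iff_abs_le_one _).2 (hφ x))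

end Averages

section Mask

variable {ι A : Type*} [DecidableEq ι] [AddCommGroup A]

/-- The restriction of a vector to the coordinates in `J`, extended by zero. -/
def mask (J : Finset ι) : (ι → A) →+ (ι → A) where
  toFun h i := if i ∈ J then h i else 0
  map_zero' := by ext; simp
  map_add' h k := by ext i; by_cases hi : i ∈ J <;> simp [hi]

lemma mask_apply (J : Finset ι) (h : ι → A) (i : ι) : mask J h i = if i ∈ J then h i else 0 := rfl

lemma mask_union (J K : Finset ι) (h : ι → A) :
    mask (J ∪ K) h = mask K h + mask J (mask (J \ K) h) := by
  ext i
  by_cases hJ : i ∈ J <;> by_cases hK : i ∈ K <;> simp [mask_apply, hJ, hK]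

lemma mask_union_mask (J K : Finset ι) (h : ι → A) : mask (J ∪ K) (mask J h) = mask J h := by
  ext i
  by_cases hJ : i ∈ J <;> simp [mask_apply, hJ]

lemma mask_mask_of_subset {J K : Finset ι} (hJK : J ⊆ K) (h : ι → A) :
    mask K (mask J h) = mask J h := by
  ext i
  by_cases hJ : i ∈ J
  · simp [mask_apply, hJ, hJK hJ]
  · simp [mask_apply, hJ]

end Mask

section CoordinateAverage

variable {ι A : Type*} [Fintype ι] [DecidableEq ι] [AddCommGroup A] [Fintype A]

/-- The average of `F` over the translates of `x` by vectors supported on `J`. -/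
noncomputable def coordAvg (J : Finset ι) (F : (ι → A) → ℝ) (x : ι → A) : ℝ :=
  𝔼 h, F (x + mask J h)

lemma coordAvg_coordAvg (J K : Finset ι) (F : (ι → A) → ℝ) :
    coordAvg J (coordAvg K F) = coordAvg (J ∪ K) F := by
  ext x
  have h1 : ∀ h : ι → A, 𝔼 k, F (x + mask (J ∪ K) k) = 𝔼 k, F (x + (mask (J ∪ K) k + mask J h)) := by
    intro h
    rw [← expect_add_right _ (mask J h)]
    simp only [map_add, mask_union_mask]
  have h2 : 𝔼 k, F (x + mask (J ∪ K) k) =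
      𝔼 h : ι → A, 𝔼 k, F (x + (mask (J ∪ K) k + mask J h)) := by
    rw [← expect_congr rfl fun h _ => h1 h, Fintype.expect_const]
  simp only [coordAvg]
  rw [h2, expect_comm]
  conv_rhs => rw [expect_comm]
  refine expect_congr rfl fun k _ => ?_
  conv_lhs => rw [← expect_add_right _ (mask (J \ K) k)]
  refine expect_congr rfl fun h _ => ?_
  rw [mask_union, map_add]
  congr 1
  abel

lemma expect_coordAvg_sq (J : Finset ι) (F : (ι → A) → ℝ) :
    𝔼 x, coordAvg J F x ^ 2 = 𝔼 h, 𝔼 x, F x * F (x + mask J h) := by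
  simp only [coordAvg, sq, expect_mul_expect]
  rw [expect_comm]
  have : ∀ h : ι → A, 𝔼 x, 𝔼 k, F (x + mask J h) * F (x + mask J k) =
      𝔼 k, 𝔼 x, F x * F (x + mask J k) := by
    intro h
    rw [expect_comm, ← expect_add_right _ h]
    refine expect_congr rfl fun k _ => ?_
    conv_rhs => rw [← expect_add_right _ (mask J h)]
    refine expect_congr rfl fun x _ => ?_
    rw [map_add]
    congr 2
    abel
  rw [expect_congr rfl fun h _ => this h, Fintype.expect_const]

lemma expect_coordAvg_sq_le (J : Finset ι) (F : (ι → A) → ℝ) :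
    𝔼 x, coordAvg J F x ^ 2 ≤ 𝔼 x, F x ^ 2 := by
  calc 𝔼 x, coordAvg J F x ^ 2 ≤ 𝔼 x, 𝔼 h, F (x + mask J h) ^ 2 :=
        expect_le_expect fun x _ => sq_expect_le _
    _ = 𝔼 x, F x ^ 2 := by
        rw [expect_comm, expect_congr rfl fun h _ => expect_add_right (fun x => F x ^ 2) (mask J h),
          Fintype.expect_const]

lemma expect_coordAvg_sq_anti {J K : Finset ι} (hJK : J ⊆ K) (F : (ι → A) → ℝ) :
    𝔼 x, coordAvg K F x ^ 2 ≤ 𝔼 x, coordAvg J F x ^ 2 := by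
  rw [← union_eq_left.2 hJK, ← coordAvg_coordAvg]
  exact expect_coordAvg_sq_le _ _

/-- The local `U²` average of `F` along directions supported on `J` and `K`. -/
noncomputable def boxNorm (J K : Finset ι) (F : (ι → A) → ℝ) : ℝ :=
  𝔼 h, 𝔼 k, 𝔼 x, F x * F (x + mask J h) * (F (x + mask K k) * F (x + mask K k + mask J h))

lemma boxNorm_comm (J K : Finset ι) (F : (ι → A) → ℝ) : boxNorm J K F = boxNorm K J F := by
  unfold boxNorm
  rw [expect_comm]
  refine expect_congr rfl fun h _ => expect_congr rfl fun k _ => expect_congr rfl fun x _ => ?_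
  rw [add_right_comm]
  ring

lemma boxNorm_eq (J K : Finset ι) (F : (ι → A) → ℝ) :
    boxNorm J K F = 𝔼 h, 𝔼 x, coordAvg K (fun y => F y * F (y + mask J h)) x ^ 2 := by
  simp only [boxNorm, expect_coordAvg_sq]

lemma boxNorm_le_inter (J K : Finset ι) (F : (ι → A) → ℝ) :
    boxNorm J K F ≤ boxNorm (J ∩ K) (J ∩ K) F := by
  have mono : ∀ J K L : Finset ι, L ⊆ K → boxNorm J K F ≤ boxNorm J L F := by
    intro J K L h
    rw [boxNorm_eq, boxNorm_eq]
    exact expect_le_expect fun _ _ => expect_coordAvg_sq_anti h _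
  refine (mono J K (J ∩ K) inter_subset_right).trans ?_
  rw [boxNorm_comm]
  exact mono _ J _ inter_subset_left

lemma boxNorm_le_one (J K : Finset ι) (F : (ι → A) → ℝ) (hF : ∀ x, |F x| ≤ 1) :
    boxNorm J K F ≤ 1 :=
  expect_le univ_nonempty fun _ _ => expect_le univ_nonempty fun _ _ =>
    expect_le univ_nonempty fun _ _ => le_of_abs_le <|
      abs_mul_le_one (abs_mul_le_one (hF _) (hF _)) (abs_mul_le_one (hF _) (hF _))

lemma boxNorm_comp_neg (J K : Finset ι) (F : (ι → A) → ℝ) :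
    boxNorm J K (fun x => F (-x)) = boxNorm J K F := by
  unfold boxNorm
  refine Fintype.expect_equiv (Equiv.neg _) _ _ fun h => ?_
  refine Fintype.expect_equiv (Equiv.neg _) _ _ fun k => ?_
  refine Fintype.expect_equiv (Equiv.neg _) _ _ fun x => ?_
  simp only [Equiv.neg_apply, map_neg, neg_add]

end CoordinateAverage

section Noise

lemma expect_sub_nsmul_sq_le {G : Type*} [AddCommGroup G] [Fintype G] (F : G → ℝ) (v : G) (k : ℕ) :
    𝔼 x, (F (x + k • v) - F x) ^ 2 ≤ k ^ 2 * 𝔼 x, (F (x + v) - F x) ^ 2 := by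
  calc 𝔼 x, (F (x + k • v) - F x) ^ 2
      = 𝔼 x, (∑ j ∈ range k, (F (x + j • v + v) - F (x + j • v))) ^ 2 := by
        refine expect_congr rfl fun x _ => ?_
        have := sum_range_sub (fun j => F (x + j • v)) k
        simp only [succ_nsmul, ← add_assoc, zero_smul, add_zero] at this
        rw [this]
    _ ≤ 𝔼 x, k * ∑ j ∈ range k, (F (x + j • v + v) - F (x + j • v)) ^ 2 :=
        expect_le_expect fun x _ => by
          simpa using sq_sum_le_card_mul_sum_sq (s := range k)
            (f := fun j => F (x + j • v + v) - F (x + j • v))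
    _ = k * ∑ j ∈ range k, 𝔼 x, (F (x + v) - F x) ^ 2 := by
        rw [← mul_expect, expect_sum_comm]
        congr 1
        exact sum_congr rfl fun j _ => expect_add_right (fun x => (F (x + v) - F x) ^ 2) (j • v)
    _ = _ := by rw [sum_const, card_range, nsmul_eq_mul]; ring

variable {ι : Type*} [Fintype ι] [DecidableEq ι] {p : ℕ} [Fact p.Prime]

/-- The averaging rate in the spectral gap of the two-point walk on `ZMod p`. -/
noncomputable def gapRate (p : ℕ) : ℝ := 1 / (2 * (p : ℝ) ^ 2)

lemma gapRate_pos : 0 < gapRate p := by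
  have : 0 < (p : ℝ) := by exact_mod_cast (Fact.out : p.Prime).pos
  unfold gapRate; positivity

lemma gapRate_lt_one : gapRate p < 1 := by
  have : 1 ≤ (p : ℝ) := by exact_mod_cast (Fact.out : p.Prime).pos
  unfold gapRate
  rw [div_lt_one (by positivity)]
  nlinarith

lemma expect_half_sq_le {c : ZMod p} (hc : c ≠ 0) (i : ι) (F : (ι → ZMod p) → ℝ) :
    𝔼 x, ((F x + F (x + Pi.single i c)) / 2) ^ 2 ≤
      (1 - gapRate p) * 𝔼 x, F x ^ 2 + gapRate p * 𝔼 x, coordAvg {i} F x ^ 2 := by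
  set v : ι → ZMod p := Pi.single i c with hv
  set W := 𝔼 x, (F (x + v) - F x) ^ 2 with hW
  have hW0 : 0 ≤ W := expect_nonneg fun x _ => sq_nonneg _
  have hp : 0 < (p : ℝ) := by exact_mod_cast (Fact.out : p.Prime).pos
  have hhalf : 𝔼 x, ((F x + F (x + v)) / 2) ^ 2 = 𝔼 x, F x ^ 2 - W / 4 := by
    have h1 : 𝔼 x, F (x + v) ^ 2 = 𝔼 x, F x ^ 2 := expect_add_right (fun x => F x ^ 2) v
    have h2 : 𝔼 x, ((F x + F (x + v)) / 2) ^ 2 =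
        𝔼 x, ((F x ^ 2 + F (x + v) ^ 2) / 2 - (F (x + v) - F x) ^ 2 / 4) :=
      expect_congr rfl fun x _ => by ring
    rw [h2, expect_sub_distrib, ← expect_div, ← expect_div, expect_add_distrib, h1]
    ring
  have hshift : ∀ h : ι → ZMod p,
      𝔼 x, F x ^ 2 - 𝔼 x, F x * F (x + mask {i} h) ≤ p ^ 2 * W / 2 := by
    intro h
    obtain ⟨k, hkp, hk⟩ : ∃ k : ℕ, k ≤ p ∧ mask {i} h = k • v := by
      refine ⟨(h i * c⁻¹).val, (ZMod.val_lt _).le, ?_⟩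
      ext j
      rw [hv, ← Pi.single_smul, nsmul_eq_mul, ZMod.natCast_zmod_val, mul_assoc, inv_mul_cancel₀ hc]
      by_cases hj : j = i
      · subst hj; simp [mask_apply]
      · simp [mask_apply, hj]
    have h1 : 𝔼 x, F (x + k • v) ^ 2 = 𝔼 x, F x ^ 2 := expect_add_right (fun x => F x ^ 2) _
    have h2 : 𝔼 x, (F (x + k • v) - F x) ^ 2 =
        2 * (𝔼 x, F x ^ 2 - 𝔼 x, F x * F (x + k • v)) := by
      have : 𝔼 x, (F (x + k • v) - F x) ^ 2 =
          𝔼 x, ((F x ^ 2 + F (x + k • v) ^ 2) - 2 * (F x * F (x + k • v))) :=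
        expect_congr rfl fun x _ => by ring
      rw [this, expect_sub_distrib, ← mul_expect, expect_add_distrib, h1]
      ring
    have h3 := expect_sub_nsmul_sq_le F v k
    have h4 : (k : ℝ) ^ 2 * W ≤ p ^ 2 * W := by gcongr
    rw [hk]
    linarith
  have hvar : 𝔼 x, F x ^ 2 - 𝔼 x, coordAvg {i} F x ^ 2 ≤ p ^ 2 * W / 2 := by
    rw [expect_coordAvg_sq]
    calc 𝔼 x, F x ^ 2 - 𝔼 h, 𝔼 x, F x * F (x + mask {i} h)
        = 𝔼 h : ι → ZMod p, (𝔼 x, F x ^ 2 - 𝔼 x, F x * F (x + mask {i} h)) := by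
          rw [expect_sub_distrib, Fintype.expect_const]
      _ ≤ _ := expect_le univ_nonempty fun h _ => hshift h
  have hfin : gapRate p * (𝔼 x, F x ^ 2 - 𝔼 x, coordAvg {i} F x ^ 2) ≤ W / 4 := by
    calc _ ≤ gapRate p * (p ^ 2 * W / 2) := mul_le_mul_of_nonneg_left hvar gapRate_pos.le
      _ = W / 4 := by unfold gapRate; field_simp; ring
  rw [hhalf]
  linarith

/-- The average of `F` over random shifts by `c` in the coordinates of `S`. -/
noncomputable def noise (c : ZMod p) (S : Finset ι) (F : (ι → ZMod p) → ℝ) (x : ι → ZMod p) : ℝ :=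
  𝔼 t ∈ S.powerset, F (x + mask t (fun _ => c))

lemma noise_insert (c : ZMod p) {S : Finset ι} {i : ι} (hi : i ∉ S) (F : (ι → ZMod p) → ℝ) :
    noise c (insert i S) F = noise c S (fun x => (F x + F (x + Pi.single i c)) / 2) := by
  ext x
  simp only [noise, expect_eq_sum_div_card, sum_powerset_insert hi, card_powerset,
    card_insert_of_notMem hi]
  rw [← sum_div, sum_add_distrib, pow_succ]
  push_cast
  have : ∀ t ∈ S.powerset, F (x + mask (insert i t) (fun _ => c)) =
      F (x + mask t (fun _ => c) + Pi.single i c) := by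
    intro t ht
    have hit : i ∉ t := fun h => hi (mem_powerset.1 ht h)
    congr 1
    rw [add_assoc]
    congr 1
    ext j
    by_cases hj : j = i
    · subst hj; simp [mask_apply, hit]
    · simp [mask_apply, hj]
  rw [sum_congr rfl this]
  field_simp

/-- The probability of `J` as a random subset of `S` containing each element with
probability `ρ`. -/
noncomputable def bernoulliWeight (ρ : ℝ) (S J : Finset ι) : ℝ := ρ ^ #J * (1 - ρ) ^ (#S - #J)

lemma coordAvg_half (J : Finset ι) (v : ι → ZMod p) (F : (ι → ZMod p) → ℝ) (x : ι → ZMod p) :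
    coordAvg J (fun x => (F x + F (x + v)) / 2) x =
      (coordAvg J F x + coordAvg J F (x + v)) / 2 := by
  unfold coordAvg
  rw [← expect_div, expect_add_distrib]
  simp only [add_right_comm]

lemma expect_noise_sq_le {c : ZMod p} (hc : c ≠ 0) (S : Finset ι) (F : (ι → ZMod p) → ℝ) :
    𝔼 x, noise c S F x ^ 2 ≤
      ∑ J ∈ S.powerset, bernoulliWeight (gapRate p) S J * 𝔼 x, coordAvg J F x ^ 2 := by
  have hρ := gapRate_pos (p := p)
  have hρ1 := gapRate_lt_one (p := p)
  induction S using Finset.induction_on generalizing F with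
  | empty => simp [noise, bernoulliWeight, coordAvg, show ∀ h : ι → ZMod p, mask ∅ h = 0
      from fun h => by ext; simp [mask_apply]]
  | insert i S hi ih =>
    rw [noise_insert c hi, sum_powerset_insert hi, ← sum_add_distrib]
    refine (ih _).trans (sum_le_sum fun J hJ => ?_)
    have hJS : J ⊆ S := mem_powerset.1 hJ
    have hiJ : i ∉ J := fun h => hi (hJS h)
    have h0 : 0 ≤ bernoulliWeight (gapRate p) S J := by
      have : 0 ≤ 1 - gapRate p := by linarith
      unfold bernoulliWeight; positivity
    have h1 : bernoulliWeight (gapRate p) (insert i S) J =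
        bernoulliWeight (gapRate p) S J * (1 - gapRate p) := by
      unfold bernoulliWeight
      rw [card_insert_of_notMem hi, Nat.sub_add_comm (card_le_card hJS), pow_succ]
      ring
    have h2 : bernoulliWeight (gapRate p) (insert i S) (insert i J) =
        bernoulliWeight (gapRate p) S J * gapRate p := by
      unfold bernoulliWeight
      rw [card_insert_of_notMem hi, card_insert_of_notMem hiJ, Nat.add_sub_add_right, pow_succ]
      ring
    have h3 := expect_half_sq_le hc i (coordAvg J F)
    rw [coordAvg_coordAvg, ← insert_eq] at h3
    simp only [coordAvg_half]
    rw [h1, h2]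
    calc _ ≤ _ := mul_le_mul_of_nonneg_left h3 h0
      _ = _ := by ring

end Noise

section Counting

variable {ι : Type*} [Fintype ι] [DecidableEq ι] {p : ℕ} [Fact p.Prime]

lemma bernoulliWeight_nonneg (S J : Finset ι) : 0 ≤ bernoulliWeight (gapRate p) S J := by
  have hρ := gapRate_pos (p := p)
  have : 0 ≤ 1 - gapRate p := by linarith [gapRate_lt_one (p := p)]
  unfold bernoulliWeight; positivity

lemma sum_bernoulliWeight (ρ : ℝ) : ∑ J : Finset ι, bernoulliWeight ρ univ J = 1 := by
  unfold bernoulliWeight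
  rw [card_univ, Fintype.sum_pow_mul_eq_add_pow]
  simp

lemma sum_bernoulliWeight_mul_pow (ρ x : ℝ) (K : Finset ι) :
    ∑ J : Finset ι, bernoulliWeight ρ univ J * x ^ #(K ∩ J) = (1 - ρ + ρ * x) ^ #K := by
  have h := Fintype.prod_add (fun i : ι => ρ * if i ∈ K then x else 1) (fun _ => 1 - ρ)
  have h1 : ∏ i : ι, ((ρ * if i ∈ K then x else 1) + (1 - ρ)) = (1 - ρ + ρ * x) ^ #K := by
    have h2 : (1 - ρ + ρ * x) ^ #K = ∏ i : ι, if i ∈ K then 1 - ρ + ρ * x else 1 := by simp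
    rw [h2]
    refine prod_congr rfl fun i _ => ?_
    split_ifs <;> ring
  rw [← h1, h]
  refine sum_congr rfl fun J _ => ?_
  rw [prod_mul_distrib, prod_const, prod_const, card_compl, prod_ite_mem, prod_const, inter_comm,
    bernoulliWeight, card_univ]
  ring

lemma sum_sum_bernoulliWeight_mul_pow (ρ : ℝ) :
    ∑ J : Finset ι, bernoulliWeight ρ univ J *
      ∑ K : Finset ι, bernoulliWeight ρ univ K * (1 / 2) ^ #(J ∩ K) =
      (1 - ρ ^ 2 / 2) ^ Fintype.card ι := by
  have h := sum_bernoulliWeight_mul_pow (ι := ι) ρ (1 - ρ + ρ * (1 / 2)) univ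
  simp only [univ_inter, card_univ] at h
  simp only [sum_bernoulliWeight_mul_pow]
  rw [h]
  ring

lemma expect_coordAvg_mul_shift_sq {A U : Type*} [AddCommGroup A] [Fintype A] [Fintype U]
    (e : U → ι → A) (J : Finset ι) (g : (ι → A) → ℝ) :
    𝔼 u, 𝔼 u', 𝔼 z, coordAvg J (fun w => g w * g (w + (e u' - e u))) z ^ 2 =
      𝔼 h, 𝔼 x, (𝔼 u, g (x + e u) * g (x + e u + mask J h)) ^ 2 := by
  have h1 : ∀ u, 𝔼 u', 𝔼 h : ι → A, 𝔼 x, g x * g (x + (e u' - e u)) *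
        (g (x + mask J h) * g (x + mask J h + (e u' - e u))) =
      𝔼 h : ι → A, 𝔼 u', 𝔼 x, g x * g (x + (e u' - e u)) *
        (g (x + mask J h) * g (x + mask J h + (e u' - e u))) := fun u => expect_comm _ _ _
  simp only [expect_coordAvg_sq]
  rw [expect_congr rfl fun u _ => h1 u, expect_comm]
  refine expect_congr rfl fun h _ => ?_
  simp only [sq, expect_mul_expect]
  rw [expect_comm (s := univ (α := ι → A))]
  refine expect_congr rfl fun u _ => ?_
  rw [expect_comm (s := univ (α := ι → A))]
  refine expect_congr rfl fun u' _ => ?_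
  rw [← expect_add_right _ (e u)]
  refine expect_congr rfl fun x _ => ?_
  rw [show x + e u + (e u' - e u) = x + e u' by abel,
    show x + e u + mask J h + (e u' - e u) = x + e u' + mask J h by abel]
  ring

/-- The number of progressions with differences `1_u + 1_t` is controlled by box norms. -/
lemma progressionCount_pow_four_le_sum (hp : p ≠ 2) (f₁ f₂ g : (ι → ZMod p) → ℝ)
    (h₁ : ∀ x, |f₁ x| ≤ 1) (h₂ : ∀ x, |f₂ x| ≤ 1) :
    progressionCount (fun t : Finset ι => mask t (fun _ => (1 : ZMod p))) f₁ f₂ g ^ 4 ≤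
      ∑ J : Finset ι, bernoulliWeight (gapRate p) univ J *
        ∑ K : Finset ι, bernoulliWeight (gapRate p) univ K * boxNorm (J ∩ K) (J ∩ K) g := by
  set e : Finset ι → ι → ZMod p := fun t => mask t (fun _ => 1) with he
  have hee : ∀ t, e t + e t = mask t (fun _ => 2) := by
    intro t
    rw [he, ← map_add]
    congr 1
    ext i
    simp [one_add_one_eq_two]
  have h2 : (2 : ZMod p) ≠ 0 := by
    intro h
    have : p ∣ 2 := (ZMod.natCast_eq_zero_iff 2 p).1 (by exact_mod_cast h)
    exact hp ((Nat.prime_dvd_prime_iff_eq Fact.out Nat.prime_two).1 this)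
  refine (progressionCount_pow_four_le e f₁ f₂ g h₁ h₂).trans ?_
  calc 𝔼 u, 𝔼 u', 𝔼 z, (𝔼 t, g (z + (e t + e t)) * g (z + (e t + e t) + (e u' - e u))) ^ 2
      = 𝔼 u, 𝔼 u', 𝔼 z, noise 2 univ (fun w => g w * g (w + (e u' - e u))) z ^ 2 := by
        simp only [noise, hee, powerset_univ]
    _ ≤ 𝔼 u, 𝔼 u', ∑ J : Finset ι, bernoulliWeight (gapRate p) univ J *
          𝔼 z, coordAvg J (fun w => g w * g (w + (e u' - e u))) z ^ 2 :=
        expect_le_expect fun u _ => expect_le_expect fun u' _ => by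
          simpa using expect_noise_sq_le h2 univ (fun w => g w * g (w + (e u' - e u)))
    _ = ∑ J : Finset ι, bernoulliWeight (gapRate p) univ J *
          𝔼 h : ι → ZMod p, 𝔼 x, noise 1 univ (fun y => g y * g (y + mask J h)) x ^ 2 := by
        simp only [expect_sum_comm, ← mul_expect]
        refine sum_congr rfl fun J _ => ?_
        congr 1
        rw [expect_coordAvg_mul_shift_sq]
        simp only [noise, powerset_univ, he]
    _ ≤ ∑ J : Finset ι, bernoulliWeight (gapRate p) univ J *
          ∑ K : Finset ι, bernoulliWeight (gapRate p) univ K * boxNorm J K g := by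
        refine sum_le_sum fun J _ =>
          mul_le_mul_of_nonneg_left ?_ (bernoulliWeight_nonneg univ J)
        simp only [boxNorm_eq, mul_expect, ← expect_sum_comm]
        refine expect_le_expect fun h _ => ?_
        simpa only [powerset_univ, mul_expect, expect_sum_comm] using
          expect_noise_sq_le (one_ne_zero) univ (fun y => g y * g (y + mask J h))
    _ ≤ _ := sum_le_sum fun J _ => mul_le_mul_of_nonneg_left
        (sum_le_sum fun K _ => mul_le_mul_of_nonneg_left (boxNorm_le_inter J K g)
          (bernoulliWeight_nonneg univ K)) (bernoulliWeight_nonneg univ J)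

lemma progressionCount_comp_neg {G U : Type*} [AddCommGroup G] [Fintype G] [Fintype U] (e : U → G)
    (f₁ f₂ f₃ : G → ℝ) :
    progressionCount e f₁ f₂ f₃ =
      progressionCount e (fun x => f₃ (-x)) (fun x => f₂ (-x)) (fun x => f₁ (-x)) := by
  unfold progressionCount
  refine expect_congr rfl fun t _ => ?_
  refine Fintype.expect_equiv (Equiv.neg _) _ _ fun y => expect_congr rfl fun u _ => ?_
  simp only [Equiv.neg_apply, neg_sub, neg_add_rev, neg_neg, sub_neg_eq_add]
  rw [show -e t + -e u + y = y - (e u + e t) by abel, add_comm (e u + e t) y]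
  ring

lemma progressionCount_pow_four_le_of_boxNorm (hp : p ≠ 2) {g : (ι → ZMod p) → ℝ}
    (hg : ∀ x, |g x| ≤ 1) {M : ℕ} {δ : ℝ} (hδ : 0 ≤ δ)
    (hbox : ∀ K : Finset ι, M ≤ #K → boxNorm K K g ≤ δ)
    (f₁ f₂ : (ι → ZMod p) → ℝ) (h₁ : ∀ x, |f₁ x| ≤ 1) (h₂ : ∀ x, |f₂ x| ≤ 1) :
    progressionCount (fun t : Finset ι => mask t (fun _ => (1 : ZMod p))) f₁ f₂ g ^ 4 ≤
      δ + 2 ^ M * (1 - gapRate p ^ 2 / 2) ^ Fintype.card ι := by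
  refine (progressionCount_pow_four_le_sum hp f₁ f₂ g h₁ h₂).trans ?_
  have hle : ∀ K : Finset ι, boxNorm K K g ≤ δ + 2 ^ M * (1 / 2) ^ #K := by
    intro K
    rcases le_total M #K with h | h
    · exact (hbox K h).trans (le_add_of_nonneg_right (by positivity))
    · refine (boxNorm_le_one K K g hg).trans (le_add_of_nonneg_of_le hδ ?_)
      rw [one_div, inv_pow, ← div_eq_mul_inv, one_le_div (by positivity)]
      exact pow_le_pow_right₀ one_le_two h
  calc _ ≤ ∑ J : Finset ι, bernoulliWeight (gapRate p) univ J *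
        ∑ K : Finset ι, bernoulliWeight (gapRate p) univ K * (δ + 2 ^ M * (1 / 2) ^ #(J ∩ K)) :=
        sum_le_sum fun J _ => mul_le_mul_of_nonneg_left
          (sum_le_sum fun K _ => mul_le_mul_of_nonneg_left (hle _)
            (bernoulliWeight_nonneg univ K)) (bernoulliWeight_nonneg univ J)
    _ = _ := by
        rw [← sum_sum_bernoulliWeight_mul_pow]
        simp only [mul_add, sum_add_distrib, ← sum_mul, sum_bernoulliWeight, one_mul,
          mul_left_comm _ ((2 : ℝ) ^ M), ← mul_sum]

end Counting

lemma AddChar.map_sum_eq_prod {κ A M : Type*} [AddCommMonoid A] [CommMonoid M]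
    (ψ : AddChar A M) (s : Finset κ) (f : κ → A) : ψ (∑ i ∈ s, f i) = ∏ i ∈ s, ψ (f i) := by
  classical
  induction s using Finset.induction_on with
  | empty => simp
  | insert i s hi ih => rw [sum_insert hi, prod_insert hi, AddChar.map_add_eq_mul, ih]

section Blocks

variable {ι : Type*} [DecidableEq ι] {p : ℕ}

lemma exists_block [Fintype ι] [Fact p.Prime] (ψ : AddChar (ι → ZMod p) ℂ) (K : Finset ι)
    (hK : p * p ≤ #K) : ∃ B ⊆ K, #B = p ∧ ψ (mask B fun _ => 1) = 1 := by
  have hp : 0 < p := (Fact.out : p.Prime).pos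
  have hroot : ∀ i : ι, ψ (Pi.single i 1) ^ p = 1 := by
    intro i
    rw [← AddChar.map_nsmul_eq_pow, ← Pi.single_smul]
    simp
  obtain ⟨z, hz, hlt⟩ := exists_lt_card_fiber_of_mul_lt_card_of_maps_to (n := p - 1) (s := K)
    (t := Polynomial.nthRootsFinset p (1 : ℂ)) (f := fun i => ψ (Pi.single i 1))
    (fun i _ => (Polynomial.mem_nthRootsFinset hp _).2 (hroot i)) (by
      rw [(Complex.isPrimitiveRoot_exp p hp.ne').card_nthRootsFinset]
      exact (Nat.mul_lt_mul_of_pos_left (Nat.sub_lt hp one_pos) hp).trans_le hK)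
  obtain ⟨B, hB, hcard⟩ := exists_subset_card_eq
    (show p ≤ #{i ∈ K | ψ (Pi.single i 1) = z} by omega)
  refine ⟨B, hB.trans (filter_subset _ _), hcard, ?_⟩
  have hsum : (mask B fun _ => (1 : ZMod p)) = ∑ i ∈ B, Pi.single i 1 := by
    ext j
    simp [mask_apply, Finset.sum_apply, Pi.single_apply]
  rw [hsum, AddChar.map_sum_eq_prod, prod_congr rfl fun i hi => (mem_filter.1 (hB hi)).2,
    prod_const, hcard]
  exact (Polynomial.mem_nthRootsFinset hp _).1 hz

lemma exists_blocks [Fintype ι] [Fact p.Prime] (ψ : AddChar (ι → ZMod p) ℂ) (m : ℕ) (K : Finset ι)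
    (hK : p * p * m ≤ #K) :
    ∃ B : Fin m → Finset ι, (∀ j, B j ⊆ K) ∧ (∀ j, (B j).Nonempty) ∧
      (∀ i j, i ≠ j → Disjoint (B i) (B j)) ∧ ∀ j, ψ (mask (B j) fun _ => 1) = 1 := by
  induction m generalizing K with
  | zero => exact ⟨fun _ => ∅, fun j => j.elim0, fun j => j.elim0, fun j => j.elim0,
      fun j => j.elim0⟩
  | succ m ih =>
    have hp : 0 < p := (Fact.out : p.Prime).pos
    obtain ⟨B₀, hB₀K, hcard, hψ⟩ := exists_block ψ K (by nlinarith)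
    obtain ⟨B, hBK, hB, hdisj, hBψ⟩ := ih (K \ B₀) (by
      rw [card_sdiff_of_subset hB₀K, hcard]
      have : p ≤ p * p := Nat.le_mul_self p
      have : p * p * (m + 1) = p * p * m + p * p := by ring
      omega)
    have h0 : ∀ j, Disjoint B₀ (B j) := fun j =>
      (disjoint_sdiff (s := B₀) (t := K)).mono_right (hBK j)
    refine ⟨Fin.cons B₀ B, ?_, ?_, ?_, ?_⟩
    · exact Fin.cases hB₀K fun j => (hBK j).trans sdiff_subset
    · exact Fin.cases (card_pos.1 (hcard ▸ hp)) hB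
    · refine Fin.cases (Fin.cases (fun h => absurd rfl h) fun j _ => h0 j) fun i =>
        Fin.cases (fun _ => (h0 i).symm) fun j hij => hdisj i j fun h => hij (h ▸ rfl)
    · exact Fin.cases hψ hBψ

/-- The vector which is constant equal to `y j` on each block `B j`. -/
def blockVector {m : ℕ} (B : Fin m → Finset ι) (y : Fin m → ZMod p) : ι → ZMod p :=
  ∑ j, mask (B j) fun _ => y j

lemma blockVector_add {m : ℕ} (B : Fin m → Finset ι) (y z : Fin m → ZMod p) :
    blockVector B (y + z) = blockVector B y + blockVector B z := by
  unfold blockVector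
  rw [← sum_add_distrib]
  exact sum_congr rfl fun j _ => map_add (mask (B j)) (fun _ => y j) (fun _ => z j)

lemma blockVector_apply_of_mem {m : ℕ} {B : Fin m → Finset ι}
    (hdisj : ∀ i j, i ≠ j → Disjoint (B i) (B j)) (y : Fin m → ZMod p) {j : Fin m} {i : ι}
    (hi : i ∈ B j) : blockVector B y i = y j := by
  rw [blockVector, Finset.sum_apply, sum_eq_single j]
  · simp [mask_apply, hi]
  · intro k _ hk
    simp [mask_apply, disjoint_left.1 (hdisj j k hk.symm) hi]
  · simp

lemma blockVector_apply_of_notMem {m : ℕ} {B : Fin m → Finset ι} (y : Fin m → ZMod p) {i : ι}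
    (hi : ∀ j, i ∉ B j) : blockVector B y i = 0 := by
  simp [blockVector, Finset.sum_apply, mask_apply, hi]

lemma mask_blockVector {m : ℕ} {B : Fin m → Finset ι} {K : Finset ι} (hBK : ∀ j, B j ⊆ K)
    (y : Fin m → ZMod p) : mask K (blockVector B y) = blockVector B y := by
  simp only [blockVector, map_sum, mask_mask_of_subset (hBK _)]

lemma addChar_blockVector [NeZero p] {m : ℕ} {B : Fin m → Finset ι} {ψ : AddChar (ι → ZMod p) ℂ}
    (hψ : ∀ j, ψ (mask (B j) fun _ => 1) = 1) (y : Fin m → ZMod p) : ψ (blockVector B y) = 1 := by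
  rw [blockVector, AddChar.map_sum_eq_prod]
  refine prod_eq_one fun j _ => ?_
  have : (mask (B j) fun _ => y j) = (y j).val • mask (B j) fun _ => (1 : ZMod p) := by
    rw [← map_nsmul]
    congr 1
    ext i
    simp
  rw [this, AddChar.map_nsmul_eq_pow, hψ, one_pow]

end Blocks

section Density

variable {p : ℕ}

lemma Restricted3APFree.comp_blockVector {n m : ℕ} {f : (Fin n → ZMod p) → ℝ}
    (hf : Restricted3APFree f) {B : Fin m → Finset (Fin n)} (hB : ∀ j, (B j).Nonempty)
    (hdisj : ∀ i j, i ≠ j → Disjoint (B i) (B j)) (c : Fin n → ZMod p) :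
    Restricted3APFree fun y : Fin m → ZMod p => f (c + blockVector B y) := by
  intro x a ha ha0
  have h := hf (c + blockVector B x) (blockVector B a) (fun i => ?_) fun h0 => ha0 ?_
  · simpa only [blockVector_add, two_nsmul, add_assoc] using h
  · by_cases hi : ∃ j, i ∈ B j
    · obtain ⟨j, hj⟩ := hi
      rw [blockVector_apply_of_mem hdisj a hj]
      exact ha j
    · exact Or.inl (blockVector_apply_of_notMem a (not_exists.1 hi))
  · ext j
    obtain ⟨i, hi⟩ := hB j
    rw [← blockVector_apply_of_mem hdisj a hi, h0]
    rfl

/-- Every restricted 3-AP free set in `𝔽_p^m` has density at most `d`. -/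
def FreeDensityLE (p : ℕ) [NeZero p] (m : ℕ) (d : ℝ) : Prop :=
  ∀ f : (Fin m → ZMod p) → ℝ, (∀ x, f x = 0 ∨ f x = 1) → Restricted3APFree f → 𝔼 x, f x ≤ d

variable [Fact p.Prime]

lemma boxNorm_sub_le {n m : ℕ} {d α ε : ℝ} (hd : FreeDensityLE p m d)
    {f : (Fin n → ZMod p) → ℝ} (hf01 : ∀ x, f x = 0 ∨ f x = 1) (hf : Restricted3APFree f)
    (hα : 𝔼 x, f x = α) (hg : ∀ x, |f x - α| ≤ 1) (hε : 0 ≤ ε) (hdε : d ≤ α + ε)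
    (K : Finset (Fin n)) (hK : p * p * m ≤ #K) :
    boxNorm K K (fun x => f x - α) ≤ 2 * ε := by
  set g : (Fin n → ZMod p) → ℝ := fun x => f x - α with hgdef
  have hbox : boxNorm K K g = 𝔼 x, 𝔼 l, 𝔼 h, 𝔼 k, g (x + mask K l) * g (x + mask K (l + h)) *
      (g (x + mask K (l + k)) * g (x + mask K (l + h + k))) := by
    rw [expect_comm]
    have : ∀ l : Fin n → ZMod p, 𝔼 x, 𝔼 h, 𝔼 k, g (x + mask K l) * g (x + mask K (l + h)) *
      (g (x + mask K (l + k)) * g (x + mask K (l + h + k))) = boxNorm K K g := by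
      intro l
      rw [expect_comm]
      refine expect_congr rfl fun h _ => ?_
      rw [expect_comm]
      refine expect_congr rfl fun k _ => ?_
      conv_rhs => rw [← expect_add_right _ (mask K l)]
      refine expect_congr rfl fun x _ => ?_
      simp only [map_add, add_assoc, add_comm (mask K h) (mask K k)]
    rw [expect_congr rfl fun l _ => this l, Fintype.expect_const]
  have hpt : ∀ x, 𝔼 l, 𝔼 h, 𝔼 k, g (x + mask K l) * g (x + mask K (l + h)) *
      (g (x + mask K (l + k)) * g (x + mask K (l + h + k))) ≤
        2 * ε - 𝔼 l, g (x + mask K l) := by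
    intro x
    set φ : (Fin n → ZMod p) → ℝ := fun l => g (x + mask K l) with hφ
    obtain ⟨ψ, hψ⟩ := exists_addChar_expect_le φ fun l => hg _
    obtain ⟨B, hBK, hB, hdisj, hBψ⟩ := exists_blocks ψ m K hK
    set X : (Fin n → ZMod p) → ℝ := fun l => 𝔼 y, φ (l + blockVector B y) with hX
    have hXle : ∀ l, X l ≤ ε := by
      intro l
      have h1 := hd _ (fun y => hf01 _) (hf.comp_blockVector hB hdisj (x + mask K l))
      have h2 : X l = 𝔼 y, f (x + mask K l + blockVector B y) - α := by
        simp only [hX, hφ, hgdef, map_add, mask_blockVector hBK, expect_sub_distrib, ← add_assoc,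
          Fintype.expect_const]
      linarith
    have hXavg : 𝔼 l, X l = 𝔼 l, φ l := by
      simp only [hX]
      rw [expect_comm, expect_congr rfl fun y _ => expect_add_right φ (blockVector B y),
        Fintype.expect_const]
    have hsum : 𝔼 l, (φ l : ℂ) * ψ l = 𝔼 l, (X l : ℂ) * ψ l := by
      simp only [hX]
      push_cast
      simp only [expect_mul]
      rw [expect_comm]
      have : ∀ y : Fin m → ZMod p, 𝔼 l, (φ (l + blockVector B y) : ℂ) * ψ l =
          𝔼 l, (φ l : ℂ) * ψ l := by
        intro y
        rw [← expect_add_right (fun l => (φ l : ℂ) * ψ l) (blockVector B y)]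
        simp only [AddChar.map_add_eq_mul, addChar_blockVector hBψ, mul_one]
      rw [expect_congr rfl fun y _ => this y, Fintype.expect_const]
    have hnorm : ∀ Y : (Fin n → ZMod p) → ℝ, ‖𝔼 l, (Y l : ℂ) * ψ l‖ ≤ 𝔼 l, |Y l| := by
      intro Y
      refine (RCLike.norm_expect_le (K := ℂ)).trans_eq (expect_congr rfl fun l _ => ?_)
      rw [norm_mul, AddChar.norm_apply, mul_one, Complex.norm_real, Real.norm_eq_abs]
    calc _ ≤ ‖𝔼 l, (φ l : ℂ) * ψ l‖ ^ 2 := hψ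
      _ ≤ ‖𝔼 l, (φ l : ℂ) * ψ l‖ := by
        refine pow_le_of_le_one (norm_nonneg _) ((hnorm φ).trans ?_) two_ne_zero
        exact expect_le univ_nonempty fun l _ => hg _
      _ = ‖𝔼 l, (X l : ℂ) * ψ l‖ := by rw [hsum]
      _ ≤ 𝔼 l, |X l| := hnorm X
      _ ≤ 𝔼 l, (2 * ε - X l) := expect_le_expect fun l _ =>
          abs_le.2 ⟨by linarith, by linarith [hXle l]⟩
      _ = _ := by rw [expect_sub_distrib, Fintype.expect_const, hXavg]
  have hg0 : 𝔼 x, g x = 0 := by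
    simp only [hgdef]
    rw [expect_sub_distrib, Fintype.expect_const, hα, sub_self]
  calc boxNorm K K g ≤ 𝔼 x, (2 * ε - 𝔼 l, g (x + mask K l)) :=
        hbox.trans_le (expect_le_expect fun x _ => hpt x)
    _ = 2 * ε := by
        rw [expect_sub_distrib, Fintype.expect_const, expect_comm,
          expect_congr rfl fun l _ => expect_add_right g (mask K l), Fintype.expect_const, hg0,
          sub_zero]

end Density

section Decay

variable {p : ℕ} [Fact p.Prime]

lemma progressionCount_le_of_free (hp : p ≠ 2) {n : ℕ} {f : (Fin n → ZMod p) → ℝ}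
    (hf01 : ∀ x, f x = 0 ∨ f x = 1) (hf : Restricted3APFree f) :
    progressionCount (fun t : Finset (Fin n) => mask t (fun _ => (1 : ZMod p))) f f f ≤
      (1 / 2) ^ n := by
  have h2 : (2 : ZMod p) ≠ 0 := by
    intro h
    have : ((2 : ℕ) : ZMod p) = 0 := by exact_mod_cast h
    rw [ZMod.natCast_eq_zero_iff] at this
    exact hp ((Nat.prime_dvd_prime_iff_eq Fact.out Nat.prime_two).1 this)
  have hterm : ∀ (t u : Finset (Fin n)) (y : Fin n → ZMod p),
      f (y - (mask u (fun _ => 1) + mask t (fun _ => 1))) * f y *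
        f (y + (mask u (fun _ => 1) + mask t (fun _ => 1))) ≤ if t = ∅ then 1 else 0 := by
    intro t u y
    set a : Fin n → ZMod p := mask u (fun _ => 1) + mask t (fun _ => 1) with ha
    split_ifs with h
    · rcases hf01 (y - a) with h1 | h1 <;> rcases hf01 y with h2 | h2 <;>
        rcases hf01 (y + a) with h3 | h3 <;> simp [h1, h2, h3]
    · have hcoord : ∀ i, a i = 0 ∨ a i = 1 ∨ a i = 2 := by
        intro i
        simp only [ha, Pi.add_apply, mask_apply]
        split_ifs <;> norm_num
      have ha0 : a ≠ 0 := by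
        obtain ⟨i, hi⟩ := nonempty_iff_ne_empty.2 h
        intro h0
        have h1 := congrFun h0 i
        simp only [ha, Pi.add_apply, mask_apply, hi, if_true, Pi.zero_apply] at h1
        split_ifs at h1
        · exact h2 (by rw [← h1]; norm_num)
        · simp at h1
      have h3 := hf (y - a) a hcoord ha0
      rw [sub_add_cancel, two_nsmul, ← add_assoc, sub_add_cancel] at h3
      rcases hf01 (y - a) with h1 | h1 <;> rcases hf01 y with h4 | h4 <;>
        rcases hf01 (y + a) with h5 | h5 <;> simp_all
  calc _ ≤ 𝔼 t : Finset (Fin n), 𝔼 _y : Fin n → ZMod p, 𝔼 _u : Finset (Fin n),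
        (if t = ∅ then (1 : ℝ) else 0) :=
        expect_le_expect fun t _ => expect_le_expect fun y _ => expect_le_expect fun u _ =>
          hterm t u y
    _ = (1 / 2) ^ n := by
        simp only [Fintype.expect_const]
        rw [Fintype.expect_eq_sum_div_card]
        simp

lemma cube_le_of_freeDensityLE (hp : p ≠ 2) {n m : ℕ} {d α ε η : ℝ} (hd : FreeDensityLE p m d)
    {f : (Fin n → ZMod p) → ℝ} (hf01 : ∀ x, f x = 0 ∨ f x = 1) (hf : Restricted3APFree f)
    (hα : 𝔼 x, f x = α) (hε : 0 ≤ ε) (hdε : d ≤ α + ε) (hη : 0 ≤ η)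
    (hsmall : 2 * ε + 2 ^ (p * p * m) * (1 - gapRate p ^ 2 / 2) ^ n ≤ η ^ 4) :
    α ^ 3 ≤ (1 / 2) ^ n + 2 * η := by
  set e : Finset (Fin n) → Fin n → ZMod p := fun t => mask t (fun _ => (1 : ZMod p)) with he
  set g : (Fin n → ZMod p) → ℝ := fun x => f x - α with hg
  have hα0 : 0 ≤ α := hα ▸ expect_nonneg fun x _ => by rcases hf01 x with h | h <;> simp [h]
  have hα1 : α ≤ 1 := hα ▸ expect_le univ_nonempty fun x _ => by
    rcases hf01 x with h | h <;> simp [h]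
  have hf1 : ∀ x, |f x| ≤ 1 := fun x => by rcases hf01 x with h | h <;> simp [h]
  have hg1 : ∀ x, |g x| ≤ 1 := fun x => by
    rcases hf01 x with h | h <;> rw [abs_le] <;> constructor <;> simp only [hg, h] <;> linarith
  have hbox : ∀ K : Finset (Fin n), p * p * m ≤ #K → boxNorm K K g ≤ 2 * ε :=
    boxNorm_sub_le hd hf01 hf hα hg1 hε hdε
  have hle : ∀ X : ℝ, X ^ 4 ≤ 2 * ε + 2 ^ (p * p * m) *
      (1 - gapRate p ^ 2 / 2) ^ Fintype.card (Fin n) → |X| ≤ η := by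
    intro X hX
    rw [Fintype.card_fin] at hX
    refine abs_le_of_sq_le_sq ((le_abs_self _).trans ?_) hη
    exact abs_le_of_sq_le_sq (by rw [← pow_mul, ← pow_mul]; exact hX.trans hsmall) (sq_nonneg η)
  have h1 : |progressionCount e g f f| ≤ η := by
    refine hle _ ?_
    rw [progressionCount_comp_neg]
    exact progressionCount_pow_four_le_of_boxNorm hp (fun x => hg1 _) (by positivity)
      (fun K hK => by rw [boxNorm_comp_neg]; exact hbox K hK) _ _ (fun x => hf1 _) fun x => hf1 _
  have h2 : |progressionCount e (fun _ => 1) f g| ≤ η :=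
    hle _ (progressionCount_pow_four_le_of_boxNorm hp hg1 (by positivity) hbox _ _
      (fun _ => by simp) hf1)
  have hexp : progressionCount e f f f =
      progressionCount e g f f + α * progressionCount e (fun _ => 1) f g + α ^ 3 := by
    have h3 : progressionCount e (fun _ => 1) f (fun _ => 1) = α := by
      simp [progressionCount, hα]
    have h4 : progressionCount e f f f = progressionCount e g f f +
        α * (progressionCount e (fun _ => 1) f g +
          α * progressionCount e (fun _ => 1) f (fun _ => 1)) := by
      simp only [progressionCount, mul_expect, ← expect_add_distrib]
      refine expect_congr rfl fun t _ => expect_congr rfl fun y _ => expect_congr rfl fun u _ => ?_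
      simp only [hg]
      ring
    rw [h4, h3]
    ring
  have h5 := progressionCount_le_of_free hp hf01 hf
  have h6 := abs_le.1 h1
  have h7 := abs_le.1 h2
  have h8 : -η ≤ α * progressionCount e (fun _ => 1) f g := by nlinarith
  linarith [hexp, h6.1]

lemma exists_freeDensityLE (hp : p ≠ 2) {δ : ℝ} (hδ : 0 < δ) :
    ∃ N, ∀ n, N ≤ n → FreeDensityLE p n δ := by
  set S : Set ℝ := {d | 0 ≤ d ∧ ∃ N, ∀ n, N ≤ n → FreeDensityLE p n d} with hS
  have hne : S.Nonempty := by
    refine ⟨1, zero_le_one, 0, fun n _ f hf01 _ => expect_le univ_nonempty fun x _ => ?_⟩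
    rcases hf01 x with h | h <;> simp [h]
  have hbdd : BddBelow S := ⟨0, fun d hd => hd.1⟩
  have hs0 : 0 ≤ sInf S := le_csInf hne fun d hd => hd.1
  set s := sInf S with hs
  rcases hs0.eq_or_lt with h0 | hpos
  · obtain ⟨d, ⟨-, N, hN⟩, hd⟩ := exists_lt_of_csInf_lt hne (show sInf S < δ by rwa [← hs, ← h0])
    exact ⟨N, fun n hn f hf01 hf => (hN n hn f hf01 hf).trans hd.le⟩
  exfalso
  set η : ℝ := s ^ 3 / 64 with hη
  have hηpos : 0 < η := by positivity
  set ε : ℝ := min (s / 2) (η ^ 4 / 8) with hε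
  have hεpos : 0 < ε := lt_min (by positivity) (by positivity)
  have hε1 : ε ≤ s / 2 := min_le_left _ _
  have hε2 : ε ≤ η ^ 4 / 8 := min_le_right _ _
  obtain ⟨d, ⟨-, m, hm⟩, hd⟩ := exists_lt_of_csInf_lt hne (show sInf S < s + ε by linarith)
  have hr0 : 0 ≤ 1 - gapRate p ^ 2 / 2 := by
    nlinarith [gapRate_pos (p := p), gapRate_lt_one (p := p)]
  have hr1 : 1 - gapRate p ^ 2 / 2 < 1 := by nlinarith [gapRate_pos (p := p)]
  have ht1 : ∀ᶠ n : ℕ in Filter.atTop,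
      (2 : ℝ) ^ (p * p * m) * (1 - gapRate p ^ 2 / 2) ^ n < η ^ 4 / 2 := by
    have := (tendsto_pow_atTop_nhds_zero_of_lt_one hr0 hr1).const_mul ((2 : ℝ) ^ (p * p * m))
    rw [mul_zero] at this
    exact this.eventually_lt_const (by positivity)
  have ht2 : ∀ᶠ n : ℕ in Filter.atTop, (1 / 2 : ℝ) ^ n < s ^ 3 / 64 :=
    (tendsto_pow_atTop_nhds_zero_of_lt_one (by norm_num) (by norm_num)).eventually_lt_const hηpos
  obtain ⟨N, hN⟩ := Filter.eventually_atTop.1 (ht1.and ht2)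
  have hnot : s - ε ∉ S := notMem_of_lt_csInf (by linarith) hbdd
  have hex : ∃ n, N ≤ n ∧ ¬ FreeDensityLE p n (s - ε) := by
    by_contra! hcon
    exact hnot ⟨by linarith, N, hcon⟩
  obtain ⟨n, hn, hfree⟩ := hex
  simp only [FreeDensityLE, not_forall, not_le] at hfree
  obtain ⟨f, hf01, hf, hlt⟩ := hfree
  obtain ⟨hn1, hn2⟩ := hN n hn
  have hcube := cube_le_of_freeDensityLE hp (hm m le_rfl) hf01 hf rfl (ε := 2 * ε) (η := η)
    (by positivity) (by linarith) hηpos.le (by linarith)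
  have : (s / 2) ^ 3 ≤ (𝔼 x, f x) ^ 3 := pow_le_pow_left₀ (by positivity) (by linarith) 3
  have h3 : 0 < s ^ 3 := by positivity
  have h4 : (s / 2) ^ 3 = s ^ 3 / 8 := by ring
  linarith

end Decay

lemma sum_le_one_of_restricted3APFree_two {n : ℕ} {f : (Fin n → ZMod 2) → ℝ}
    (hf01 : ∀ x, f x = 0 ∨ f x = 1) (hf : Restricted3APFree f) : ∑ x, f x ≤ 1 := by
  have huniq : ∀ x y, f x = 1 → f y = 1 → x = y := by
    intro x y hx hy
    by_contra hxy
    refine hf x (y - x) (fun i => ?_) (sub_ne_zero.2 (Ne.symm hxy)) ⟨hx, by simpa using hy, ?_⟩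
    · generalize (y - x) i = z
      revert z
      decide
    · rwa [show (2 • (y - x) : Fin n → ZMod 2) = 0 from by
        ext i; rw [two_nsmul]; exact CharTwo.add_self_eq_zero ((y - x) i), add_zero]
  by_cases h : ∃ x, f x = 1
  · obtain ⟨x, hx⟩ := h
    rw [sum_eq_single x (fun y _ hy => (hf01 y).resolve_right fun h => hy (huniq y x h hx))
      (by simp), hx]
  · push Not at h
    rw [sum_eq_zero fun x _ => (hf01 x).resolve_right (h x)]
    exact zero_le_one

lemma exists_freeDensityLE_two {δ : ℝ} (hδ : 0 < δ) :
    ∃ N, ∀ n, N ≤ n → FreeDensityLE 2 n δ := by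
  obtain ⟨N, hN⟩ := exists_pow_lt_of_lt_one hδ (show (1 / 2 : ℝ) < 1 by norm_num)
  refine ⟨N, fun n hn f hf01 hf => ?_⟩
  rw [Fintype.expect_eq_sum_div_card]
  calc _ ≤ (1 : ℝ) / Fintype.card (Fin n → ZMod 2) := by
        gcongr
        exact sum_le_one_of_restricted3APFree_two hf01 hf
    _ = (1 / 2) ^ n := by simp [ZMod.card]
    _ ≤ (1 / 2) ^ N := pow_le_pow_of_le_one (by norm_num) (by norm_num) hn
    _ ≤ δ := hN.le

end RestrictedProgressions

/-- **Basic density increment step.** For every prime `p` there is `C = C(p) > 0` such that for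
every `α > 0` there are `α' = γ ≥ exp(-C·exp(1/α^C)) > 0` such that for all sufficiently large
`n`: any restricted 3-AP free `f : 𝔽_p^n → {0,1}` of average `α` yields a restricted 3-AP free
`g : 𝔽_p^{n'} → {0,1}` with `n' ≥ γ·n` and average at least `α + α'`. -/
theorem density_increment_step (p : ℕ) (hp : p.Prime) [NeZero p] :
    ∃ C : ℝ, 0 < C ∧
      ∀ α : ℝ, 0 < α →
        ∃ α' γ : ℝ, 0 < α' ∧ 0 < γ ∧ α' = γ ∧
          Real.exp (-C * Real.exp (1 / α ^ C)) ≤ γ ∧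
          ∃ N : ℕ, ∀ n : ℕ, N ≤ n →
            ∀ f : (Fin n → ZMod p) → ℝ, (∀ x, f x = 0 ∨ f x = 1) →
              (∑ x, f x) / (p : ℝ) ^ n = α →
              Restricted3APFree f →
              ∃ n' : ℕ, γ * n ≤ (n' : ℝ) ∧
                ∃ g : (Fin n' → ZMod p) → ℝ, (∀ x, g x = 0 ∨ g x = 1) ∧
                  Restricted3APFree g ∧
                  α + α' ≤ (∑ x, g x) / (p : ℝ) ^ n' := by
  have : Fact p.Prime := ⟨hp⟩
  refine ⟨1, one_pos, fun α hα => ⟨1, 1, one_pos, one_pos, rfl, ?_, ?_⟩⟩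
  · rw [Real.exp_le_one_iff, neg_one_mul, neg_nonpos]
    exact Real.exp_nonneg _
  have hdens : ∃ N, ∀ n, N ≤ n → FreeDensityLE p n (α / 2) := by
    by_cases h2 : p = 2
    · subst h2
      exact exists_freeDensityLE_two (half_pos hα)
    · exact exists_freeDensityLE h2 (half_pos hα)
  obtain ⟨N, hN⟩ := hdens
  refine ⟨N, fun n hn f hf01 hfα hf => absurd (hN n hn f hf01 hf) (not_le.2 ?_)⟩
  have hcard : (Fintype.card (Fin n → ZMod p) : ℝ) = (p : ℝ) ^ n := by simp [ZMod.card]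
  rw [Fintype.expect_eq_sum_div_card, hcard, hfα]
  exact half_lt_self hα
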